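/- Let w : ℝ → ℝ be differentiable and set q(x) = √(1+w(x)²) and P(x) = √((1+q(x))/(2q(x)))·[[1, w(x)/(1+q(x))], [−w(x)/(1+q(x)), 1]]. Then for every x, P is differentiable at x and P′(x)·P(x)ᵀ = (w′(x)/(2q(x)²))·[[0,1],[−1,0]]. -/

import Mathlib

open Matrix

/-- The orthogonal matrix `P(w)` used in the gauge transformation of the Lax pair
of the short pulse equation, with `q = √(1+w²)`. -/
noncomputable def Pmat (w : ℝ) : Matrix (Fin 2) (Fin 2) ℝ :=
  Real.sqrt ((1 + Real.sqrt (1 + w ^ 2)) / (2 * Real.sqrt (1 + w ^ 2))) •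
    !![1, w / (1 + Real.sqrt (1 + w ^ 2)); -(w / (1 + Real.sqrt (1 + w ^ 2))), 1]

/-- The diagonal entry of `Pmat (w x)`, i.e. the cosine of the rotation angle, has derivative
`-sin θ * θ'` with `θ' = w' / (2 * q ^ 2)`. -/
theorem hasDerivAt_Pmat_diag {w : ℝ → ℝ} {w' x : ℝ} (hw : HasDerivAt w w' x) :
    HasDerivAt (fun y => √((1 + √(1 + w y ^ 2)) / (2 * √(1 + w y ^ 2))))
      (-(√((1 + √(1 + w x ^ 2)) / (2 * √(1 + w x ^ 2))) * (w x / (1 + √(1 + w x ^ 2)))) *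
        (w' / (2 * √(1 + w x ^ 2) ^ 2))) x := by
  have hpos : 0 < 1 + w x ^ 2 := by positivity
  have hq := Real.sqrt_pos.2 hpos
  have hsqrt := ((hw.pow 2).const_add 1).sqrt hpos.ne'
  have hrpos : 0 < (1 + √(1 + w x ^ 2)) / (2 * √(1 + w x ^ 2)) := by positivity
  have hc := Real.sqrt_pos.2 hrpos
  have hcsq := Real.sq_sqrt hrpos.le
  refine (((hsqrt.const_add 1).div (hsqrt.const_mul 2)
    (by simpa using hq.ne')).sqrt hrpos.ne').congr_deriv ?_
  simp only [Pi.pow_apply, Pi.div_apply]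
  generalize √((1 + √(1 + w x ^ 2)) / (2 * √(1 + w x ^ 2))) = c at hc hcsq ⊢
  generalize √(1 + w x ^ 2) = q at hq hcsq ⊢
  field_simp at hcsq ⊢
  linear_combination (2 * w x * w') * hcsq

/-- The upper off-diagonal entry of `Pmat (w x)`, i.e. the sine of the rotation angle, has
derivative `cos θ * θ'` with `θ' = w' / (2 * q ^ 2)`. -/
theorem hasDerivAt_Pmat_offDiag {w : ℝ → ℝ} {w' x : ℝ} (hw : HasDerivAt w w' x) :
    HasDerivAt (fun y => √((1 + √(1 + w y ^ 2)) / (2 * √(1 + w y ^ 2))) *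
        (w y / (1 + √(1 + w y ^ 2))))
      (√((1 + √(1 + w x ^ 2)) / (2 * √(1 + w x ^ 2))) * (w' / (2 * √(1 + w x ^ 2) ^ 2))) x := by
  have hpos : 0 < 1 + w x ^ 2 := by positivity
  have hq := Real.sqrt_pos.2 hpos
  have hqsq := Real.sq_sqrt hpos.le
  have hsqrt := ((hw.pow 2).const_add 1).sqrt hpos.ne'
  refine ((hasDerivAt_Pmat_diag hw).mul
    (hw.div (hsqrt.const_add 1) (by positivity))).congr_deriv ?_
  simp only [Pi.pow_apply, Pi.div_apply]
  generalize √((1 + √(1 + w x ^ 2)) / (2 * √(1 + w x ^ 2))) = c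
  generalize √(1 + w x ^ 2) = q at hq hqsq ⊢
  field_simp
  linear_combination (c * w' * (1 + 2 * q)) * hqsq

theorem Pmat_diag_sq_add_offDiag_sq (w : ℝ) :
    √((1 + √(1 + w ^ 2)) / (2 * √(1 + w ^ 2))) ^ 2 +
      (√((1 + √(1 + w ^ 2)) / (2 * √(1 + w ^ 2))) * (w / (1 + √(1 + w ^ 2)))) ^ 2 = 1 := by
  have hpos : 0 < 1 + w ^ 2 := by positivity
  have hq := Real.sqrt_pos.2 hpos
  have hqsq := Real.sq_sqrt hpos.le
  rw [mul_pow, Real.sq_sqrt (by positivity)]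
  generalize √(1 + w ^ 2) = q at hq hqsq ⊢
  field_simp
  linear_combination -hqsq

/-- If `w : ℝ → ℝ` is differentiable then `x ↦ P(w(x))` is differentiable (entrywise)
and `P′(x)·P(x)ᵀ = (w′(x)/(2q(x)²))·[[0,1],[−1,0]]` with `q(x) = √(1+w(x)²)`. -/
theorem Pmat_deriv (w : ℝ → ℝ) (hw : Differentiable ℝ w) (x : ℝ) :
    (∀ i j, DifferentiableAt ℝ (fun y => Pmat (w y) i j) x) ∧
    (Matrix.of fun i j => deriv (fun y => Pmat (w y) i j) x) * (Pmat (w x))ᵀ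
      = (deriv w x / (2 * Real.sqrt (1 + w x ^ 2) ^ 2)) • !![0, 1; -1, 0] := by
  have hd := hasDerivAt_Pmat_diag (hw x).hasDerivAt
  have ho := hasDerivAt_Pmat_offDiag (hw x).hasDerivAt
  have hone := Pmat_diag_sq_add_offDiag_sq (w x)
  have h00 := hd.congr_of_eventuallyEq (f₁ := fun y => Pmat (w y) 0 0)
    (.of_forall fun y => by simp [Pmat])
  have h01 := ho.congr_of_eventuallyEq (f₁ := fun y => Pmat (w y) 0 1)
    (.of_forall fun y => by simp [Pmat])
  have h10 := ho.neg.congr_of_eventuallyEq (f₁ := fun y => Pmat (w y) 1 0)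
    (.of_forall fun y => by simp [Pmat])
  have h11 := hd.congr_of_eventuallyEq (f₁ := fun y => Pmat (w y) 1 1)
    (.of_forall fun y => by simp [Pmat])
  constructor
  · intro i j
    fin_cases i <;> fin_cases j
    exacts [h00.differentiableAt, h01.differentiableAt, h10.differentiableAt,
      h11.differentiableAt]
  · ext i j
    fin_cases i <;> fin_cases j <;>
      simp only [mul_apply, Fin.sum_univ_two, of_apply, transpose_apply, Fin.zero_eta,
        Fin.mk_one, h00.deriv, h01.deriv, h10.deriv, h11.deriv] <;>
      simp only [Pmat, Matrix.smul_apply, of_apply, cons_val', cons_val_zero, cons_val_one,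
        cons_val_fin_one, smul_eq_mul]
    · ring
    · linear_combination (deriv w x / (2 * √(1 + w x ^ 2) ^ 2)) * hone
    · linear_combination -(deriv w x / (2 * √(1 + w x ^ 2) ^ 2)) * hone
    · ring
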